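/- Let A be an r × n complex matrix and X = diag(x_1,…,x_n). If Re(x_i) > 0 for all i, then det(A X A*) ≠ 0 or A X A* is identically singular; more precisely, if rank A = r then det(A X A*) ≠ 0 whenever Re(x_i) > 0 for all i. -/

import Mathlib

open Matrix

theorem mulVec_injective_of_rank_eq_card {K m n : Type*} [Field K] [Fintype m] [Fintype n]
    (A : Matrix m n K) (hA : A.rank = Fintype.card n) : Function.Injective A.mulVec := by
  have h := A.mulVecLin.finrank_range_add_finrank_ker
  rw [Module.finrank_fintype_fun_eq_card] at h
  have hker : Module.finrank K (LinearMap.ker A.mulVecLin) = 0 := by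
    unfold Matrix.rank at hA
    omega
  exact LinearMap.ker_eq_bot.mp (Submodule.finrank_eq_zero.mp hker)

theorem re_star_dotProduct_diagonal_mulVec {n : Type*} [Fintype n] [DecidableEq n]
    (x w : n → ℂ) :
    (star w ⬝ᵥ (diagonal x *ᵥ w)).re = ∑ i, (x i).re * Complex.normSq (w i) := by
  simp only [dotProduct, mulVec_diagonal, Complex.re_sum, Pi.star_apply]
  refine Finset.sum_congr rfl fun i _ => ?_
  simp [Complex.normSq_apply]
  ring

theorem eq_zero_of_star_dotProduct_diagonal_mulVec_eq_zero {n : Type*} [Fintype n]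
    [DecidableEq n] {x w : n → ℂ} (hx : ∀ i, 0 < (x i).re)
    (h : star w ⬝ᵥ (diagonal x *ᵥ w) = 0) : w = 0 := by
  have hsum := re_star_dotProduct_diagonal_mulVec x w
  rw [h, Complex.zero_re, eq_comm, Finset.sum_eq_zero_iff_of_nonneg
    fun i _ => mul_nonneg (hx i).le (Complex.normSq_nonneg _)] at hsum
  ext i
  simpa [(hx i).ne'] using hsum i (Finset.mem_univ i)

theorem stmt1 {r n : ℕ} (A : Matrix (Fin r) (Fin n) ℂ) (hA : A.rank = r)
    (x : Fin n → ℂ) (hx : ∀ i, 0 < (x i).re) :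
    (A * Matrix.diagonal x * Aᴴ).det ≠ 0 := by
  intro hdet
  obtain ⟨v, hv, hAv⟩ := exists_mulVec_eq_zero_iff.mpr hdet
  have hform : star (Aᴴ *ᵥ v) ⬝ᵥ (diagonal x *ᵥ (Aᴴ *ᵥ v)) = 0 := by
    rw [star_mulVec, conjTranspose_conjTranspose, ← dotProduct_mulVec, mulVec_mulVec,
      mulVec_mulVec, hAv, dotProduct_zero]
  have hw := eq_zero_of_star_dotProduct_diagonal_mulVec_eq_zero hx hform
  refine hv (mulVec_injective_of_rank_eq_card Aᴴ ?_ (hw.trans (mulVec_zero _).symm))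
  open scoped ComplexOrder in rw [rank_conjTranspose, hA, Fintype.card_fin]
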